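/- Let s > 5/2 and α > −s. There exists a constant C = C(s,α) > 0 such that for every smooth divergence-free vector field b on 𝕋³ and every smooth function V on 𝕋³ one has ‖Λ^α [Λ^s, b·∇] V‖_{L²(𝕋³)} ≤ C ( ‖b‖_{H^s} ‖V‖_{H^{s+α}} + ‖b‖_{H^{s+α}} ‖V‖_{H^s} ). -/

import Mathlib

/-!
We model functions on the torus `𝕋³ = ℝ³/ℤ³` by their Fourier coefficients,
indexed by `n ∈ ℤ³` (the actual frequency being `k = 2πn ∈ 2πℤ³`).
Smoothness corresponds to rapid decay of the Fourier coefficients, real-valuedness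
to the usual conjugation symmetry, products to convolution of coefficients, and
the `L²` norm/inner product are given by Plancherel.
-/

noncomputable section

open scoped BigOperators
open Complex

/-- Fourier frequencies of functions on `𝕋³`, indexed by `n ∈ ℤ³`; the actual
frequency is `k = 2πn ∈ 2πℤ³`. -/
abbrev Z3 : Type := Fin 3 → ℤ

/-- The Euclidean length `|k|` of the frequency `k = 2πn`. -/
def knorm (n : Z3) : ℝ := 2 * Real.pi * Real.sqrt (∑ i, ((n i : ℝ)) ^ 2)

/-- `Λ^s = (−Δ)^{s/2}` as a Fourier multiplier: `(Λ^s f)^_k = |k|^s f^_k`. -/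
def lam (s : ℝ) (c : Z3 → ℂ) : Z3 → ℂ :=
  fun n => Complex.ofReal (knorm n ^ s) * c n

/-- Squared `L²(𝕋³)` norm (Plancherel). -/
def l2sq (c : Z3 → ℂ) : ℝ := ∑' n : Z3, ‖c n‖ ^ 2

/-- `L²(𝕋³)` norm. -/
def l2norm (c : Z3 → ℂ) : ℝ := Real.sqrt (l2sq c)

/-- `L²(𝕋³)` inner product of two real-valued functions (Plancherel). -/
def inner2 (c d : Z3 → ℂ) : ℝ := (∑' n : Z3, c n * (starRingEnd ℂ) (d n)).re

/-- Sobolev `H^σ` norm: `(∑_k (1+|k|^{2σ})|f^_k|²)^{1/2}`. -/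
def hnorm (σ : ℝ) (c : Z3 → ℂ) : ℝ :=
  Real.sqrt (∑' n : Z3, (1 + knorm n ^ (2 * σ)) * ‖c n‖ ^ 2)

/-- The partial derivative `∂_j` as a Fourier multiplier. -/
def pd (j : Fin 3) (c : Z3 → ℂ) : Z3 → ℂ :=
  fun n => Complex.I * Complex.ofReal (2 * Real.pi * (n j : ℝ)) * c n

/-- Pointwise product of two functions = convolution of Fourier coefficients. -/
def conv (c d : Z3 → ℂ) : Z3 → ℂ := fun n => ∑' m : Z3, c m * d (n - m)

/-- The coefficients of a real-valued function. -/
def IsRealFn (c : Z3 → ℂ) : Prop := ∀ n : Z3, c (-n) = (starRingEnd ℂ) (c n)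

/-- Rapid decay of the Fourier coefficients, i.e. smoothness of the function. -/
def RapidDecay (c : Z3 → ℂ) : Prop :=
  ∀ N : ℕ, ∃ C : ℝ, ∀ n : Z3, ‖c n‖ * (1 + knorm n) ^ N ≤ C

/-- A smooth real-valued function on `𝕋³`, described by its Fourier coefficients. -/
def SmoothFun (c : Z3 → ℂ) : Prop := IsRealFn c ∧ RapidDecay c

/-- Zero mean. -/
def ZeroMean (c : Z3 → ℂ) : Prop := c 0 = 0

/-- A divergence-free vector field `b = (b¹,b²,b³)`: `∀ k, ∑_j k_j b^j_k = 0`. -/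
def DivFree (b : Fin 3 → Z3 → ℂ) : Prop :=
  ∀ n : Z3, ∑ j : Fin 3, (n j : ℂ) * b j n = 0

/-- The transport operator `b·∇ = b¹∂_{x₁} + b²∂_{x₂} + b³∂_z`. -/
def transport (b : Fin 3 → Z3 → ℂ) (c : Z3 → ℂ) : Z3 → ℂ :=
  fun n => ∑ j : Fin 3, conv (b j) (pd j c) n

/-- The commutator `[Λ^s, b·∇]`. -/
def commLam (s : ℝ) (b : Fin 3 → Z3 → ℂ) (c : Z3 → ℂ) : Z3 → ℂ :=
  lam s (transport b c) - transport b (lam s c)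

/-- `H^σ` norm of a 3-component vector field. -/
def hnormV3 (σ : ℝ) (b : Fin 3 → Z3 → ℂ) : ℝ :=
  Real.sqrt (∑ j : Fin 3, (hnorm σ (b j)) ^ 2)

/-- `Λ^s` acting componentwise on ℝ²-valued functions. -/
def lamV (s : ℝ) (V : Fin 2 → Z3 → ℂ) : Fin 2 → Z3 → ℂ := fun i => lam s (V i)

/-- `b·∇` acting componentwise on ℝ²-valued functions. -/
def transportV (b : Fin 3 → Z3 → ℂ) (V : Fin 2 → Z3 → ℂ) : Fin 2 → Z3 → ℂ :=
  fun i => transport b (V i)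

/-- `[Λ^s, b·∇]` acting componentwise on ℝ²-valued functions. -/
def commLamV (s : ℝ) (b : Fin 3 → Z3 → ℂ) (V : Fin 2 → Z3 → ℂ) : Fin 2 → Z3 → ℂ :=
  fun i => commLam s b (V i)

/-- `L²` norm of an ℝ²-valued function. -/
def l2normV (V : Fin 2 → Z3 → ℂ) : ℝ := Real.sqrt (∑ i : Fin 2, l2sq (V i))

/-- `L²` inner product of ℝ²-valued functions. -/
def inner2V (V W : Fin 2 → Z3 → ℂ) : ℝ := ∑ i : Fin 2, inner2 (V i) (W i)

/-- `H^σ` norm of an ℝ²-valued function. -/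
def hnormV2 (σ : ℝ) (V : Fin 2 → Z3 → ℂ) : ℝ :=
  Real.sqrt (∑ i : Fin 2, (hnorm σ (V i)) ^ 2)

/-- The hydrostatic Leray projection `𝒫φ = φ − ∇_h Δ_h^{-1} ∇_h · φ̄` as a Fourier
multiplier: the barotropic part `φ̄` consists of the modes with `n₃ = 0`, on which
`∇_h Δ_h^{-1} ∇_h ·` acts as `φ̂ ↦ n_h (n_h · φ̂)/|n_h|²` (for `n_h ≠ 0`). -/
def hproj (V : Fin 2 → Z3 → ℂ) : Fin 2 → Z3 → ℂ := fun i n =>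
  if n 2 = 0 ∧ ¬(n 0 = 0 ∧ n 1 = 0) then
    V i n - (n i.castSucc : ℂ) * ((n 0 : ℂ) * V 0 n + (n 1 : ℂ) * V 1 n) /
      (((n 0 : ℂ)) ^ 2 + ((n 1 : ℂ)) ^ 2)
  else V i n

/-- `ℚ = I − 𝒫`. -/
def qproj (V : Fin 2 → Z3 → ℂ) : Fin 2 → Z3 → ℂ := fun i => V i - hproj V i

/-- The commutator `[𝒫, b·∇]` on ℝ²-valued functions. -/
def commProj (b : Fin 3 → Z3 → ℂ) (V : Fin 2 → Z3 → ℂ) : Fin 2 → Z3 → ℂ :=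
  fun i => hproj (transportV b V) i - transportV b (hproj V) i

/-- A smooth ℝ²-valued function on `𝕋³`. -/
def SmoothV2 (V : Fin 2 → Z3 → ℂ) : Prop := ∀ i, SmoothFun (V i)

/-- A smooth vector field on `𝕋³`. -/
def SmoothV3 (b : Fin 3 → Z3 → ℂ) : Prop := ∀ j, SmoothFun (b j)

/-- `∂_z b^h = ∂_z (b¹, b²)`. -/
def dzbh (b : Fin 3 → Z3 → ℂ) : Fin 2 → Z3 → ℂ := fun i => pd 2 (b i.castSucc)

/-- `𝒫B V = 𝒫(b·∇V)`. -/
def PB (b : Fin 3 → Z3 → ℂ) (V : Fin 2 → Z3 → ℂ) : Fin 2 → Z3 → ℂ :=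
  hproj (transportV b V)

lemma knorm_nonneg (n : Z3) : 0 ≤ knorm n := by unfold knorm; positivity

lemma knorm_eq (n : Z3) :
    knorm n = 2 * Real.pi * ‖(WithLp.toLp 2 (fun i => (n i : ℝ)) : EuclideanSpace ℝ (Fin 3))‖ := by
  simp [knorm, EuclideanSpace.norm_eq]

lemma knorm_add_le (m n : Z3) : knorm (m + n) ≤ knorm m + knorm n := by
  simp only [knorm_eq]
  rw [← mul_add]
  have h : (WithLp.toLp 2 (fun i => ((m + n) i : ℝ)) : EuclideanSpace ℝ (Fin 3))
      = WithLp.toLp 2 (fun i => (m i : ℝ)) + WithLp.toLp 2 (fun i => (n i : ℝ)) := by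
    ext i; simp
  rw [h]
  gcongr
  exact norm_add_le _ _

lemma knorm_neg (n : Z3) : knorm (-n) = knorm n := by simp [knorm]

lemma knorm_zero : knorm 0 = 0 := by simp [knorm]

lemma abs_le_knorm (n : Z3) (j : Fin 3) : 2 * Real.pi * |(n j : ℝ)| ≤ knorm n := by
  unfold knorm
  gcongr
  apply Real.abs_le_sqrt
  exact Finset.single_le_sum (f := fun i => ((n i : ℝ)) ^ 2) (fun i _ => sq_nonneg _)
    (Finset.mem_univ j)

lemma knorm_pos (n : Z3) (hn : n ≠ 0) : 0 < knorm n := by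
  obtain ⟨j, hj⟩ := Function.ne_iff.mp hn
  refine lt_of_lt_of_le ?_ (abs_le_knorm n j)
  have : (n j : ℝ) ≠ 0 := by exact_mod_cast hj
  have := Real.pi_pos
  positivity

lemma summable_knorm_rpow (r : ℝ) (hr : r < -3) : Summable fun n : Z3 => knorm n ^ r := by
  let B := (EuclideanSpace.basisFun (Fin 3) ℝ).toBasis
  let L := Submodule.span ℤ (Set.range B)
  have hfin : Module.finrank ℤ L = 3 := by
    rw [ZLattice.rank ℝ L]; simp
  have hs := ZLattice.summable_norm_rpow L r (by rw [hfin]; exact_mod_cast hr)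
  have hmem : ∀ n : Z3, (WithLp.toLp 2 (fun i => (n i : ℝ)) : EuclideanSpace ℝ (Fin 3)) ∈ L := by
    intro n
    have : (WithLp.toLp 2 (fun i => (n i : ℝ)) : EuclideanSpace ℝ (Fin 3))
        = ∑ i, n i • B i := by
      ext j
      simp [B, Pi.single_apply, Finset.sum_apply]
    rw [this]
    exact Submodule.sum_mem _ fun i _ => Submodule.smul_mem _ _
      (Submodule.subset_span (Set.mem_range_self i))
  let f : Z3 → L := fun n => ⟨_, hmem n⟩
  have hf : Function.Injective f := by
    intro m n h
    have h2 := congrArg Subtype.val h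
    ext i
    have h3 := congrArg (fun v : EuclideanSpace ℝ (Fin 3) => v i) h2
    simpa [f] using h3
  have h := (hs.comp_injective hf).mul_left ((2 * Real.pi) ^ r)
  refine h.congr fun n => ?_
  rw [knorm_eq, Real.mul_rpow (by positivity) (norm_nonneg _)]
  rfl

lemma rapid_summable (c : Z3 → ℂ) (hc : RapidDecay c) (σ : ℝ) :
    Summable fun n => (1 + knorm n) ^ σ * ‖c n‖ := by
  obtain ⟨N, hN⟩ := exists_nat_ge (σ + 4)
  obtain ⟨C, hC⟩ := hc N
  have hs := (summable_knorm_rpow (-4) (by norm_num)).mul_left C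
  refine Summable.of_norm_bounded_eventually hs ?_
  have : ∀ᶠ n : Z3 in Filter.cofinite, n ≠ 0 := by
    simp
  filter_upwards [this] with n hn
  have hk := knorm_pos n hn
  have h1 : (1:ℝ) ≤ 1 + knorm n := by linarith
  have h0 : (0:ℝ) < 1 + knorm n := by linarith
  rw [Real.norm_of_nonneg (by positivity)]
  have hC0 : 0 ≤ C := le_trans (by positivity) (hC n)
  calc (1 + knorm n) ^ σ * ‖c n‖ ≤ (1 + knorm n) ^ ((N:ℝ) + (-4)) * ‖c n‖ := by
        gcongr
        linarith
    _ = ‖c n‖ * (1 + knorm n) ^ N * (1 + knorm n) ^ (-4 : ℝ) := by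
        rw [Real.rpow_add h0, Real.rpow_natCast]; ring
    _ ≤ C * (1 + knorm n) ^ (-4 : ℝ) := by gcongr; exact hC n
    _ ≤ C * knorm n ^ (-4 : ℝ) := by
        gcongr C * ?_
        exact Real.rpow_le_rpow_of_nonpos hk (by linarith) (by norm_num)

lemma rapid_bdd (c : Z3 → ℂ) (hc : RapidDecay c) (σ : ℝ) :
    ∃ C, ∀ n, (1 + knorm n) ^ σ * ‖c n‖ ≤ C := by
  refine ⟨∑' n, (1 + knorm n) ^ σ * ‖c n‖, fun n => ?_⟩
  exact (rapid_summable c hc σ).le_tsum n fun m _ => by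
    have := knorm_nonneg m; positivity

lemma hnorm_summable (c : Z3 → ℂ) (hc : RapidDecay c) (σ : ℝ) (hσ : 0 ≤ σ) :
    Summable fun n => (1 + knorm n ^ (2 * σ)) * ‖c n‖ ^ 2 := by
  obtain ⟨C, hC⟩ := rapid_bdd c hc 0
  refine Summable.of_nonneg_of_le (fun n => ?_) (fun n => ?_)
    ((rapid_summable c hc (2 * σ)).mul_left (2 * C))
  · have := knorm_nonneg n; positivity
  · have hk := knorm_nonneg n
    have h1 : knorm n ^ (2 * σ) ≤ (1 + knorm n) ^ (2 * σ) := by gcongr; linarith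
    have h2 : 1 ≤ (1 + knorm n) ^ (2 * σ) := Real.one_le_rpow (by linarith) (by linarith)
    have h3 := hC n
    rw [Real.rpow_zero, one_mul] at h3
    have hC0 : 0 ≤ C := le_trans (norm_nonneg _) h3
    calc (1 + knorm n ^ (2 * σ)) * ‖c n‖ ^ 2
        ≤ (2 * (1 + knorm n) ^ (2 * σ)) * (C * ‖c n‖) := by
          gcongr
          · linarith
          · rw [sq]; gcongr
      _ = _ := by ring

lemma rpow_sub_le (a b s : ℝ) (hb : 0 ≤ b) (ha : 0 < a) (hs : 1 ≤ s) :
    a ^ s - b ^ s ≤ s * a ^ (s - 1) * (a - b) := by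
  have h := one_add_mul_self_le_rpow_one_add (s := b / a - 1) (by
    have : 0 ≤ b / a := by positivity
    linarith) hs
  rw [show 1 + (b / a - 1) = b / a by ring, Real.div_rpow hb ha.le,
    le_div_iff₀ (by positivity)] at h
  rw [Real.rpow_sub_one ha.ne']
  have : (1 + s * (b / a - 1)) * a ^ s = a ^ s - s * (a ^ s / a) * (a - b) := by
    field_simp; ring
  linarith

lemma rpow_comp (K Q α : ℝ) (hQ : 0 < Q) (h1 : Q / 2 ≤ K) (h2 : K ≤ 2 * Q) :
    K ^ α ≤ 2 ^ |α| * Q ^ α := by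
  have hK : 0 < K := by linarith
  rcases le_total 0 α with h | h
  · rw [abs_of_nonneg h, ← Real.mul_rpow (by norm_num) hQ.le]
    gcongr
  · rw [abs_of_nonpos h]
    have : (2:ℝ) ^ (-α) * Q ^ α = (Q / 2) ^ α := by
      rw [Real.div_rpow hQ.le (by norm_num), Real.rpow_neg (by norm_num)]; field_simp
    rw [this]
    exact Real.rpow_le_rpow_of_nonpos (by linarith) h1 h

/-- The pointwise bound for the multiplier. -/
lemma mult_bound (s α : ℝ) (hs : 5 / 2 < s) (hα : -s < α) :
    ∃ C : ℝ, 0 < C ∧ ∀ K P Q : ℝ, 0 < K → 0 < P → 0 < Q → K ≤ P + Q → P ≤ K + Q → Q ≤ K + P →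
      K ^ α * |K ^ s - Q ^ s| * min Q K ≤
        C * (P ^ (1 - s) * P ^ s * Q ^ (s + α) + Q ^ (1 - s) * P ^ (s + α) * Q ^ s
          + K ^ (1 - s) * P ^ s * Q ^ (s + α)) := by
  set c1 : ℝ := 2 ^ |α| * s * 2 ^ (s - 1) with hc1
  set c2 : ℝ := 2 ^ |α| * 2 ^ s with hc2
  set c3 : ℝ := 3 ^ s * 2 ^ s * 3 ^ (s + α) with hc3
  have hc1p : 0 < c1 := by positivity
  have hc2p : 0 < c2 := by positivity
  have hc3p : 0 < c3 := by positivity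
  refine ⟨c1 + c2 + c3, by positivity, ?_⟩
  intro K P Q hK hP hQ h1 h2 h3
  have hA : P ^ (1 - s) * P ^ s * Q ^ (s + α) = P * Q ^ (s + α) := by
    rw [← Real.rpow_add hP]; simp
  have hB : Q ^ (1 - s) * P ^ (s + α) * Q ^ s = Q * P ^ (s + α) := by
    rw [mul_right_comm, ← Real.rpow_add hQ]; simp
  rw [hA, hB]
  set A := P * Q ^ (s + α) with hAd
  set B := Q * P ^ (s + α) with hBd
  set D := K ^ (1 - s) * P ^ s * Q ^ (s + α) with hDd
  have hA0 : 0 ≤ A := by positivity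
  have hB0 : 0 ≤ B := by positivity
  have hD0 : 0 ≤ D := by positivity
  have expand : (c1 + c2 + c3) * (A + B + D) = c1 * A + c2 * B + c3 * D
    + (c1 * B + c1 * D + c2 * A + c2 * D + c3 * A + c3 * B) := by ring
  have rest : 0 ≤ c1 * B + c1 * D + c2 * A + c2 * D + c3 * A + c3 * B := by positivity
  have r1 : 0 ≤ c1 * A := by positivity
  have r2 : 0 ≤ c2 * B := by positivity
  have r3 : 0 ≤ c3 * D := by positivity
  rcases le_total P (Q / 2) with hPQ | hPQ
  · -- low frequencies of `b`
    have hd : |K ^ s - Q ^ s| ≤ s * (2 * Q) ^ (s - 1) * P := by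
      rcases le_total K Q with hKQ | hKQ
      · have := rpow_sub_le Q K s hK.le hQ (by linarith)
        rw [abs_sub_comm, abs_of_nonneg (sub_nonneg.mpr (by gcongr))]
        refine this.trans ?_
        gcongr
        · linarith
        · linarith
        · linarith
      · have := rpow_sub_le K Q s hQ.le hK (by linarith)
        rw [abs_of_nonneg (sub_nonneg.mpr (by gcongr))]
        refine this.trans ?_
        gcongr
        · linarith
        · linarith
        · linarith
    have hk := rpow_comp K Q α hQ (by linarith) (by linarith)
    have : K ^ α * |K ^ s - Q ^ s| * min Q K ≤ c1 * A := by
      calc K ^ α * |K ^ s - Q ^ s| * min Q K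
          ≤ (2 ^ |α| * Q ^ α) * (s * (2 * Q) ^ (s - 1) * P) * Q := by
            gcongr
            exact min_le_left _ _
        _ = c1 * A := by
            rw [Real.mul_rpow (by norm_num) hQ.le, hAd, hc1, Real.rpow_add hQ,
              Real.rpow_sub_one hQ.ne']
            field_simp
    linarith
  rcases le_total Q (P / 2) with hQP | hQP
  · have hd : |K ^ s - Q ^ s| ≤ (2 * P) ^ s := by
      have e1 : K ^ s ≤ (2 * P) ^ s := by gcongr; linarith
      have e2 : Q ^ s ≤ (2 * P) ^ s := by gcongr; linarith
      have e3 : 0 ≤ K ^ s := by positivity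
      have e4 : 0 ≤ Q ^ s := by positivity
      rw [abs_le]; constructor <;> linarith
    have hk := rpow_comp K P α hP (by linarith) (by linarith)
    have : K ^ α * |K ^ s - Q ^ s| * min Q K ≤ c2 * B := by
      calc K ^ α * |K ^ s - Q ^ s| * min Q K
          ≤ (2 ^ |α| * P ^ α) * ((2 * P) ^ s) * Q := by
            gcongr
            exact min_le_left _ _
        _ = c2 * B := by
            rw [Real.mul_rpow (by norm_num) hP.le, hBd, hc2, Real.rpow_add hP]
            ring
    linarith
  · have hd : |K ^ s - Q ^ s| ≤ 3 ^ s * (2 ^ s * P ^ s) := by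
      rw [← Real.mul_rpow (by norm_num) hP.le, ← Real.mul_rpow (by norm_num) (by positivity)]
      have e1 : K ^ s ≤ (3 * (2 * P)) ^ s := by gcongr; linarith
      have e2 : Q ^ s ≤ (3 * (2 * P)) ^ s := by gcongr; linarith
      have e3 : 0 ≤ K ^ s := by positivity
      have e4 : 0 ≤ Q ^ s := by positivity
      rw [abs_le]; constructor <;> linarith
    have hk : K ^ (s + α) ≤ 3 ^ (s + α) * Q ^ (s + α) := by
      rw [← Real.mul_rpow (by norm_num) hQ.le]
      gcongr
      · linarith
      · linarith
    have hk2 : K ^ α * K = K ^ (1 - s) * K ^ (s + α) := by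
      rw [← Real.rpow_add hK, ← Real.rpow_add_one hK.ne']; congr 1; ring
    have : K ^ α * |K ^ s - Q ^ s| * min Q K ≤ c3 * D := by
      calc K ^ α * |K ^ s - Q ^ s| * min Q K
          ≤ K ^ α * (3 ^ s * (2 ^ s * P ^ s)) * K := by
            gcongr
            exact min_le_right _ _
        _ = (3 ^ s * (2 ^ s * P ^ s)) * (K ^ (1 - s) * K ^ (s + α)) := by rw [← hk2]; ring
        _ ≤ (3 ^ s * (2 ^ s * P ^ s)) * (K ^ (1 - s) * (3 ^ (s + α) * Q ^ (s + α))) := by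
            gcongr
        _ = c3 * D := by rw [hDd, hc3]; ring
    linarith

open scoped ENNReal in
lemma cs_ennreal {ι : Type*} (F G : ι → ℝ≥0∞) :
    (∑' p, F p * G p) ^ 2 ≤ (∑' p, F p ^ 2) * (∑' p, G p ^ 2) := by
  let _ : MeasurableSpace ι := ⊤
  have h := ENNReal.lintegral_mul_le_Lp_mul_Lq (MeasureTheory.Measure.count : MeasureTheory.Measure ι)
    (p := 2) (q := 2) (Real.HolderConjugate.two_two) (f := F) (g := G)
    (measurable_from_top.aemeasurable) (measurable_from_top.aemeasurable)
  simp only [MeasureTheory.lintegral_count, Pi.mul_apply] at h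
  calc (∑' p, F p * G p) ^ 2
      ≤ ((∑' p, F p ^ (2 : ℝ)) ^ (1 / 2 : ℝ) * (∑' p, G p ^ (2 : ℝ)) ^ (1 / 2 : ℝ)) ^ 2 := by
        gcongr
    _ = _ := by
      rw [mul_pow]
      simp only [← ENNReal.rpow_natCast, ← ENNReal.rpow_mul]
      norm_num

open scoped ENNReal in
lemma three_sq (a b c : ℝ≥0∞) : (a + b + c) ^ 2 ≤ 3 * (a ^ 2 + b ^ 2 + c ^ 2) := by
  have h := cs_ennreal (ι := Fin 3) (fun _ => 1) ![a, b, c]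
  simpa [tsum_fintype, Fin.sum_univ_three] using h

open scoped ENNReal in
lemma conv_sum (G H : Z3 → ℝ≥0∞) :
    ∑' n, ∑' p, G p * H (n - p) = (∑' p, G p) * ∑' p, H p := by
  rw [ENNReal.tsum_comm]
  simp_rw [ENNReal.tsum_mul_left]
  have : ∀ p : Z3, ∑' n, H (n - p) = ∑' n, H n := fun p =>
    (Equiv.subRight p).tsum_eq H
  simp_rw [this]
  rw [ENNReal.tsum_mul_right]

open scoped ENNReal in
lemma tri1 (F G H : Z3 → ℝ≥0∞) :
    ∑' n, (∑' p, F p * (G p * H (n - p))) ^ 2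
      ≤ (∑' p, F p ^ 2) * ((∑' p, G p ^ 2) * ∑' p, H p ^ 2) := by
  rw [← conv_sum, ← ENNReal.tsum_mul_left]
  refine ENNReal.tsum_le_tsum fun n => ?_
  simpa only [mul_pow] using cs_ennreal F (fun p => G p * H (n - p))

open scoped ENNReal in
lemma tri2 (F G H : Z3 → ℝ≥0∞) :
    ∑' n, (∑' p, F (n - p) * (G p * H (n - p))) ^ 2
      ≤ (∑' p, F p ^ 2) * ((∑' p, G p ^ 2) * ∑' p, H p ^ 2) := by
  rw [← conv_sum, ← ENNReal.tsum_mul_left]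
  refine ENNReal.tsum_le_tsum fun n => ?_
  have h := cs_ennreal (fun p => F (n - p)) (fun p => G p * H (n - p))
  have e : ∑' p, F (n - p) ^ 2 = ∑' p, F p ^ 2 := (Equiv.subLeft n).tsum_eq (fun p => F p ^ 2)
  rw [e] at h
  simpa only [mul_pow] using h

open scoped ENNReal in
lemma tri3 (F G H : Z3 → ℝ≥0∞) :
    ∑' n, (∑' p, F n * (G p * H (n - p))) ^ 2
      ≤ (∑' p, F p ^ 2) * ((∑' p, G p ^ 2) * ∑' p, H p ^ 2) := by
  rw [← ENNReal.tsum_mul_right]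
  refine ENNReal.tsum_le_tsum fun n => ?_
  rw [ENNReal.tsum_mul_left, mul_pow]
  have e : ∑' p, H (n - p) ^ 2 = ∑' p, H p ^ 2 := (Equiv.subLeft n).tsum_eq (fun p => H p ^ 2)
  have h := cs_ennreal G (fun p => H (n - p))
  rw [e] at h
  gcongr

lemma norm_dot_le (n : Z3) (w : Fin 3 → ℂ) :
    ‖∑ j, ((2 * Real.pi * (n j : ℝ) : ℝ) : ℂ) * w j‖ ≤ knorm n * ∑ j, ‖w j‖ := by
  rw [Finset.mul_sum]
  refine (norm_sum_le _ _).trans (Finset.sum_le_sum fun j _ => ?_)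
  rw [norm_mul, Complex.norm_real, Real.norm_eq_abs, abs_mul, abs_of_nonneg (by positivity)]
  gcongr
  exact abs_le_knorm n j

/-- The divergence-free condition allows replacing `n - m` by `n`. -/
lemma dot_eq (b : Fin 3 → Z3 → ℂ) (hb : DivFree b) (n m : Z3) :
    ∑ j, ((2 * Real.pi * ((n - m) j : ℝ) : ℝ) : ℂ) * b j m
      = ∑ j, ((2 * Real.pi * (n j : ℝ) : ℝ) : ℂ) * b j m := by
  have h := hb m
  rw [← sub_eq_zero, ← Finset.sum_sub_distrib]
  have : ∀ j, ((2 * Real.pi * ((n - m) j : ℝ) : ℝ) : ℂ) * b j m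
      - ((2 * Real.pi * (n j : ℝ) : ℝ) : ℂ) * b j m = (-(2 * Real.pi)) * ((m j : ℂ) * b j m) := by
    intro j; simp; ring
  simp_rw [this]
  rw [← Finset.mul_sum, h, mul_zero]

lemma conv_summable (b V : Z3 → ℂ) (hb : RapidDecay b) (n : Z3) (C : ℝ) (hV : ∀ n, ‖V n‖ ≤ C) :
    Summable fun m => b m * V (n - m) := by
  have h := (rapid_summable b hb 0).mul_right C
  refine Summable.of_norm_bounded h fun m => ?_
  rw [Real.rpow_zero, one_mul, norm_mul]
  gcongr
  exact hV _

lemma pd_lam_bdd (V : Z3 → ℂ) (hV : RapidDecay V) (j : Fin 3) (s : ℝ) (hs : 0 ≤ s) :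
    ∃ C, ∀ n, ‖pd j (lam s V) n‖ ≤ C := by
  obtain ⟨C, hC⟩ := rapid_bdd V hV (1 + s)
  refine ⟨C, fun n => le_trans ?_ (hC n)⟩
  have hk := knorm_nonneg n
  simp only [pd, lam, norm_mul, Complex.norm_I, one_mul, Complex.norm_real, Real.norm_eq_abs]
  rw [← mul_assoc]
  gcongr
  rw [Real.rpow_add (by linarith), Real.rpow_one, abs_of_nonneg (Real.rpow_nonneg hk s)]
  gcongr
  · have := abs_le_knorm n j
    rw [abs_of_pos Real.pi_pos, abs_two]
    linarith
  · linarith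

lemma commLam_eq (s : ℝ) (hs : 0 < s) (b : Fin 3 → Z3 → ℂ) (hb : SmoothV3 b) (V : Z3 → ℂ)
    (hV : SmoothFun V) (n : Z3) :
    commLam s b V n = ∑' m, ((knorm n ^ s - knorm (n - m) ^ s : ℝ) : ℂ) * (Complex.I * V (n - m) *
      ∑ j, ((2 * Real.pi * ((n - m) j : ℝ) : ℝ) : ℂ) * b j m) := by
  have h0 : lam 0 V = V := by ext n; simp [lam]
  have s1 : ∀ j, Summable fun m => b j m * pd j V (n - m) := by
    intro j
    obtain ⟨C, hC⟩ := pd_lam_bdd V hV.2 j 0 le_rfl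
    rw [h0] at hC
    exact conv_summable _ _ (hb j).2 n C hC
  have s2 : ∀ j, Summable fun m => b j m * pd j (lam s V) (n - m) := by
    intro j
    obtain ⟨C, hC⟩ := pd_lam_bdd V hV.2 j s hs.le
    exact conv_summable _ _ (hb j).2 n C hC
  change Complex.ofReal (knorm n ^ s) * (∑ j, ∑' m, b j m * pd j V (n - m))
    - ∑ j, ∑' m, b j m * pd j (lam s V) (n - m) = _
  rw [← Summable.tsum_finsetSum (fun j _ => s1 j), ← Summable.tsum_finsetSum (fun j _ => s2 j),
    ← tsum_mul_left, ← Summable.tsum_sub]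
  · refine tsum_congr fun m => ?_
    simp only [Fin.sum_univ_three, pd, lam]
    push_cast
    ring
  · exact (summable_sum fun j _ => s1 j).mul_left _
  · exact summable_sum fun j _ => s2 j

lemma term_bound (s α : ℝ) (hs : 5 / 2 < s) (hα : -s < α) :
    ∃ C : ℝ, 0 < C ∧ ∀ n m : Z3, ∀ T β v : ℝ, 0 ≤ β → 0 ≤ v → 0 ≤ T →
      T ≤ knorm (n - m) * β → T ≤ knorm n * β →
      knorm n ^ α * (|knorm n ^ s - knorm (n - m) ^ s| * (v * T)) ≤
        C * (knorm m ^ (1 - s) * ((knorm m ^ s * β) * (knorm (n - m) ^ (s + α) * v))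
          + knorm (n - m) ^ (1 - s) * ((knorm m ^ (s + α) * β) * (knorm (n - m) ^ s * v))
          + knorm n ^ (1 - s) * ((knorm m ^ s * β) * (knorm (n - m) ^ (s + α) * v))) := by
  obtain ⟨C, hC, h⟩ := mult_bound s α hs hα
  refine ⟨C, hC, ?_⟩
  intro n m T β v hβ hv hT hT1 hT2
  have k1 := knorm_nonneg n
  have k2 := knorm_nonneg m
  have k3 := knorm_nonneg (n - m)
  have hR : 0 ≤ C * (knorm m ^ (1 - s) * ((knorm m ^ s * β) * (knorm (n - m) ^ (s + α) * v))
          + knorm (n - m) ^ (1 - s) * ((knorm m ^ (s + α) * β) * (knorm (n - m) ^ s * v))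
          + knorm n ^ (1 - s) * ((knorm m ^ s * β) * (knorm (n - m) ^ (s + α) * v))) := by
    positivity
  by_cases hn : n = 0
  · have : T = 0 := le_antisymm (by simpa [hn, knorm_zero] using hT2) hT
    rw [this]; simpa using hR
  by_cases hm : m = 0
  · subst hm
    rw [sub_zero] at hR ⊢
    rw [sub_self]; simpa using hR
  by_cases hq : n - m = 0
  · have : T = 0 := le_antisymm (by simpa [hq, knorm_zero] using hT1) hT
    rw [this]; simpa using hR
  have t1 := knorm_add_le m (n - m)
  rw [add_sub_cancel] at t1
  have t2 := knorm_add_le n (-(n - m))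
  rw [knorm_neg, show n + -(n - m) = m by abel] at t2
  have t3 := knorm_add_le n (-m)
  rw [knorm_neg, ← sub_eq_add_neg] at t3
  have hh := h _ _ _ (knorm_pos n hn) (knorm_pos m hm) (knorm_pos _ hq) t1 t2 t3
  have hT3 : T ≤ min (knorm (n - m)) (knorm n) * β := by
    rcases min_choice (knorm (n - m)) (knorm n) with e | e <;> rw [e] <;> assumption
  calc knorm n ^ α * (|knorm n ^ s - knorm (n - m) ^ s| * (v * T))
      ≤ knorm n ^ α * (|knorm n ^ s - knorm (n - m) ^ s| * (v *
        (min (knorm (n - m)) (knorm n) * β))) := by gcongr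
    _ = (knorm n ^ α * |knorm n ^ s - knorm (n - m) ^ s| * min (knorm (n - m)) (knorm n)) *
        (v * β) := by ring
    _ ≤ _ := mul_le_mul_of_nonneg_right hh (by positivity)
    _ = _ := by ring

lemma sobolev_ennreal (σ : ℝ) (hσ : 0 < σ) (c : Z3 → ℂ) (hc : RapidDecay c) :
    ∑' n, ENNReal.ofReal (knorm n ^ σ * ‖c n‖) ^ 2 ≤ ENNReal.ofReal (hnorm σ c ^ 2) := by
  rw [hnorm, Real.sq_sqrt (tsum_nonneg fun n => by have := knorm_nonneg n; positivity),
    ENNReal.ofReal_tsum_of_nonneg (fun n => by have := knorm_nonneg n; positivity)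
      (hnorm_summable c hc σ hσ.le)]
  refine ENNReal.tsum_le_tsum fun n => ?_
  have hk := knorm_nonneg n
  rw [← ENNReal.ofReal_pow (by positivity)]
  apply ENNReal.ofReal_le_ofReal
  rw [mul_pow, ← Real.rpow_natCast (knorm n ^ σ), ← Real.rpow_mul hk,
    show σ * ((2 : ℕ) : ℝ) = 2 * σ by push_cast; ring]
  gcongr
  linarith

lemma sobolev_ennreal_vec (σ : ℝ) (hσ : 0 < σ) (b : Fin 3 → Z3 → ℂ) (hb : SmoothV3 b) :
    ∑' n, ENNReal.ofReal (knorm n ^ σ * ∑ j, ‖b j n‖) ^ 2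
      ≤ ENNReal.ofReal (3 * hnormV3 σ b ^ 2) := by
  have h3 : hnormV3 σ b ^ 2 = ∑ j, hnorm σ (b j) ^ 2 :=
    Real.sq_sqrt (Finset.sum_nonneg fun j _ => sq_nonneg _)
  have : ENNReal.ofReal (3 * hnormV3 σ b ^ 2) = 3 * (ENNReal.ofReal (hnorm σ (b 0) ^ 2)
      + ENNReal.ofReal (hnorm σ (b 1) ^ 2) + ENNReal.ofReal (hnorm σ (b 2) ^ 2)) := by
    rw [h3, ENNReal.ofReal_mul (by norm_num), Fin.sum_univ_three,
      ENNReal.ofReal_add (by positivity) (by positivity),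
      ENNReal.ofReal_add (by positivity) (by positivity)]
    norm_num
  rw [this]
  refine le_trans ?_ (mul_le_mul_right (add_le_add (add_le_add
    (sobolev_ennreal σ hσ (b 0) (hb 0).2) (sobolev_ennreal σ hσ (b 1) (hb 1).2))
    (sobolev_ennreal σ hσ (b 2) (hb 2).2)) 3)
  rw [← ENNReal.tsum_add, ← ENNReal.tsum_add, ← ENNReal.tsum_mul_left]
  refine ENNReal.tsum_le_tsum fun n => ?_
  have hk := knorm_nonneg n
  rw [Fin.sum_univ_three, mul_add, mul_add, ENNReal.ofReal_add (by positivity) (by positivity),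
    ENNReal.ofReal_add (by positivity) (by positivity)]
  exact three_sq _ _ _

/-- Let `s > 5/2` and `α > −s`. There is `C = C(s,α) > 0` such that
for every smooth divergence-free vector field `b` on `𝕋³` and every smooth function `V`
on `𝕋³`, `‖Λ^α [Λ^s, b·∇] V‖_{L²} ≤ C (‖b‖_{H^s} ‖V‖_{H^{s+α}} + ‖b‖_{H^{s+α}} ‖V‖_{H^s})`. -/
theorem stmt0 (s α : ℝ) (hs : 5 / 2 < s) (hα : -s < α) :
    ∃ C : ℝ, 0 < C ∧
      ∀ b : Fin 3 → Z3 → ℂ, SmoothV3 b → DivFree b →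
        ∀ V : Z3 → ℂ, SmoothFun V →
          l2norm (lam α (commLam s b V)) ≤
            C * (hnormV3 s b * hnorm (s + α) V + hnormV3 (s + α) b * hnorm s V) := by
  obtain ⟨C, hC, hterm⟩ := term_bound s α hs hα
  have hsum := summable_knorm_rpow (2 * (1 - s)) (by linarith)
  set Φ : ℝ := ∑' n : Z3, knorm n ^ (2 * (1 - s)) with hΦ
  have hΦ0 : 0 ≤ Φ := tsum_nonneg fun n => Real.rpow_nonneg (knorm_nonneg n) _
  have hΦe : ∑' n : Z3, ENNReal.ofReal (knorm n ^ (1 - s)) ^ 2 = ENNReal.ofReal Φ := by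
    rw [hΦ, ENNReal.ofReal_tsum_of_nonneg (fun n => Real.rpow_nonneg (knorm_nonneg n) _) hsum]
    refine tsum_congr fun n => ?_
    have hk := knorm_nonneg n
    rw [← ENNReal.ofReal_pow (by positivity), ← Real.rpow_natCast (knorm n ^ (1 - s)),
      ← Real.rpow_mul hk]
    congr 2
    push_cast; ring
  refine ⟨18 * C ^ 2 * Φ + 1, by positivity, ?_⟩
  intro b hb hdiv V hV
  have hs0 : 0 < s := by linarith
  have hsα : 0 < s + α := by linarith
  set bs := hnormV3 s b with hbs
  set ba := hnormV3 (s + α) b with hba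
  set vs := hnorm s V with hvs
  set va := hnorm (s + α) V with hva
  have bs0 : 0 ≤ bs := Real.sqrt_nonneg _
  have ba0 : 0 ≤ ba := Real.sqrt_nonneg _
  have vs0 : 0 ≤ vs := Real.sqrt_nonneg _
  have va0 : 0 ≤ va := Real.sqrt_nonneg _
  let F : Z3 → ENNReal := fun n => ENNReal.ofReal (knorm n ^ (1 - s))
  let G : ℝ → Z3 → ENNReal := fun σ n => ENNReal.ofReal (knorm n ^ σ * ∑ j, ‖b j n‖)
  let H : ℝ → Z3 → ENNReal := fun σ n => ENNReal.ofReal (knorm n ^ σ * ‖V n‖)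
  have hGs : ∑' n, G s n ^ 2 ≤ ENNReal.ofReal (3 * bs ^ 2) := sobolev_ennreal_vec s hs0 b hb
  have hGa : ∑' n, G (s + α) n ^ 2 ≤ ENNReal.ofReal (3 * ba ^ 2) :=
    sobolev_ennreal_vec (s + α) hsα b hb
  have hHs : ∑' n, H s n ^ 2 ≤ ENNReal.ofReal (vs ^ 2) := sobolev_ennreal s hs0 V hV.2
  have hHa : ∑' n, H (s + α) n ^ 2 ≤ ENNReal.ofReal (va ^ 2) :=
    sobolev_ennreal (s + α) hsα V hV.2
  -- pointwise bound
  have hpt : ∀ n, ‖lam α (commLam s b V) n‖ₑ ≤ ENNReal.ofReal C *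
      (∑' m, F m * (G s m * H (s + α) (n - m)) + ∑' m, F (n - m) * (G (s + α) m * H s (n - m))
        + ∑' m, F n * (G s m * H (s + α) (n - m))) := by
    intro n
    rw [lam, commLam_eq s hs0 b hb V hV, ← tsum_mul_left, ← ENNReal.tsum_add, ← ENNReal.tsum_add,
      ← ENNReal.tsum_mul_left]
    refine enorm_tsum_le_tsum_enorm.trans (ENNReal.tsum_le_tsum fun m => ?_)
    have k1 := knorm_nonneg n
    have k2 := knorm_nonneg m
    have k3 := knorm_nonneg (n - m)
    have hb0 : 0 ≤ ∑ j, ‖b j m‖ := Finset.sum_nonneg fun j _ => norm_nonneg _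
    have hT := hterm n m ‖∑ j, ((2 * Real.pi * ((n - m) j : ℝ) : ℝ) : ℂ) * b j m‖
      (∑ j, ‖b j m‖) ‖V (n - m)‖ hb0 (norm_nonneg _) (norm_nonneg _)
      (norm_dot_le (n - m) fun j => b j m)
      (by rw [dot_eq b hdiv n m]; exact norm_dot_le n fun j => b j m)
    simp only [F, G, H]
    rw [← ENNReal.ofReal_mul (by positivity), ← ENNReal.ofReal_mul (by positivity),
      ← ENNReal.ofReal_mul (by positivity), ← ENNReal.ofReal_mul (by positivity),
      ← ENNReal.ofReal_mul (by positivity), ← ENNReal.ofReal_add (by positivity) (by positivity),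
      ← ENNReal.ofReal_add (by positivity) (by positivity), ← ENNReal.ofReal_mul hC.le,
      ← ofReal_norm]
    apply ENNReal.ofReal_le_ofReal
    refine le_trans (le_of_eq ?_) hT
    rw [norm_mul, norm_mul, norm_mul, norm_mul, Complex.norm_I, one_mul, Complex.norm_real,
      Complex.norm_real, Real.norm_eq_abs, Real.norm_eq_abs,
      abs_of_nonneg (Real.rpow_nonneg k1 α)]
  have hS : ∑' n, ‖lam α (commLam s b V) n‖ₑ ^ 2
      ≤ ENNReal.ofReal (C ^ 2 * (3 * (Φ * (3 * bs ^ 2 * va ^ 2) + Φ * (3 * ba ^ 2 * vs ^ 2)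
        + Φ * (3 * bs ^ 2 * va ^ 2)))) := by
    calc ∑' n, ‖lam α (commLam s b V) n‖ₑ ^ 2
        ≤ ∑' n, ENNReal.ofReal C ^ 2 * (3 * ((∑' m, F m * (G s m * H (s + α) (n - m))) ^ 2
          + (∑' m, F (n - m) * (G (s + α) m * H s (n - m))) ^ 2
          + (∑' m, F n * (G s m * H (s + α) (n - m))) ^ 2)) := by
          refine ENNReal.tsum_le_tsum fun n => ?_
          refine (pow_le_pow_left' (hpt n) 2).trans ?_
          rw [mul_pow]
          gcongr
          exact three_sq _ _ _
      _ ≤ ENNReal.ofReal C ^ 2 * (3 * (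
          ENNReal.ofReal Φ * (ENNReal.ofReal (3 * bs ^ 2) * ENNReal.ofReal (va ^ 2))
          + ENNReal.ofReal Φ * (ENNReal.ofReal (3 * ba ^ 2) * ENNReal.ofReal (vs ^ 2))
          + ENNReal.ofReal Φ * (ENNReal.ofReal (3 * bs ^ 2) * ENNReal.ofReal (va ^ 2)))) := by
          rw [ENNReal.tsum_mul_left, ENNReal.tsum_mul_left, ENNReal.tsum_add, ENNReal.tsum_add]
          gcongr
          · refine (tri1 _ _ _).trans ?_
            rw [hΦe]; gcongr
          · refine (tri2 _ _ _).trans ?_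
            rw [hΦe]; gcongr
          · refine (tri3 _ _ _).trans ?_
            rw [hΦe]; gcongr
      _ = _ := by
          have h3 : (3 : ENNReal) = ENNReal.ofReal 3 := by norm_num
          rw [h3, ← ENNReal.ofReal_pow hC.le]
          rw [← ENNReal.ofReal_mul (p := 3 * bs ^ 2) (by positivity),
            ← ENNReal.ofReal_mul (p := 3 * ba ^ 2) (by positivity),
            ← ENNReal.ofReal_mul hΦ0, ← ENNReal.ofReal_mul hΦ0,
            ← ENNReal.ofReal_add (by positivity) (by positivity),
            ← ENNReal.ofReal_add (by positivity) (by positivity),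
            ← ENNReal.ofReal_mul (by positivity), ← ENNReal.ofReal_mul (by positivity)]
  have hl2 : l2sq (lam α (commLam s b V)) ≤ C ^ 2 * (3 * (Φ * (3 * bs ^ 2 * va ^ 2)
      + Φ * (3 * ba ^ 2 * vs ^ 2) + Φ * (3 * bs ^ 2 * va ^ 2))) := by
    have e : l2sq (lam α (commLam s b V)) = (∑' n, ‖lam α (commLam s b V) n‖ₑ ^ 2).toReal := by
      rw [ENNReal.tsum_toReal_eq (fun n => by simp)]
      simp [l2sq]
    rw [e]
    exact ENNReal.toReal_le_of_le_ofReal (by positivity) hS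
  rw [l2norm]
  apply Real.sqrt_le_iff.mpr
  refine ⟨by positivity, hl2.trans ?_⟩
  set A := bs * va with hA
  set B := ba * vs with hB
  have hA0 : 0 ≤ A := by positivity
  have hB0 : 0 ≤ B := by positivity
  set D := 18 * C ^ 2 * Φ with hD
  have hD0 : 0 ≤ D := by positivity
  calc C ^ 2 * (3 * (Φ * (3 * bs ^ 2 * va ^ 2)
      + Φ * (3 * ba ^ 2 * vs ^ 2) + Φ * (3 * bs ^ 2 * va ^ 2)))
      = D * (A ^ 2 + B ^ 2 / 2) := by rw [hA, hB, hD]; ring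
    _ ≤ (D + 1) ^ 2 * (A + B) ^ 2 := by
        gcongr
        · nlinarith
        · nlinarith [mul_nonneg hA0 hB0]
    _ = _ := by ring
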